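/- Let S = {v_1, ..., v_n} be a finite set of points in ℝ^m (n ≥ 1) and let p ∈ ℝ^m. Then p does not lie in the convex hull of S if and only if there exists a point p' in the convex hull of S such that ‖p' − v_i‖ < ‖p − v_i‖ for every i = 1, ..., n. -/

import Mathlib

section InnerProductSpace

variable {E : Type*} [NormedAddCommGroup E] [InnerProductSpace ℝ E]

/-- Being closer to `a` than to `b` is an open half-space condition. -/
theorem norm_sub_lt_norm_sub_iff_inner (a b x : E) :
    ‖a - x‖ < ‖b - x‖ ↔ inner ℝ (b - a) x < (‖b‖ ^ 2 - ‖a‖ ^ 2) / 2 := by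
  rw [← sq_lt_sq₀ (norm_nonneg _) (norm_nonneg _), norm_sub_sq_real, norm_sub_sq_real,
    inner_sub_left]
  constructor <;> intro h <;> linarith

theorem convex_setOf_norm_sub_lt (a b : E) : Convex ℝ {x | ‖a - x‖ < ‖b - x‖} := by
  simp only [norm_sub_lt_norm_sub_iff_inner]
  exact convex_halfSpace_lt (innerₗ E (b - a)).isLinear _

/-- A point outside a complete convex set has a point of the set strictly closer to every point
of the set, namely its projection. -/
theorem Convex.exists_forall_norm_sub_lt {K : Set E} (hK : Convex ℝ K) (hne : K.Nonempty)
    (hc : IsComplete K) {p : E} (hp : p ∉ K) :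
    ∃ q ∈ K, ∀ x ∈ K, ‖q - x‖ < ‖p - x‖ := by
  obtain ⟨q, hq, hmin⟩ := exists_norm_eq_iInf_of_complete_convex hne hc hK p
  refine ⟨q, hq, fun x hx => ?_⟩
  have hinner := (norm_eq_iInf_iff_real_inner_le_zero hK hq).1 hmin x hx
  have hpos : 0 < ‖p - q‖ := norm_pos_iff.2 (sub_ne_zero.2 fun h => hp (h ▸ hq))
  have hsq := norm_sub_sq_real (p - q) (x - q)
  rw [sub_sub_sub_cancel_right, norm_sub_rev x q] at hsq
  rw [← sq_lt_sq₀ (norm_nonneg _) (norm_nonneg _)]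
  nlinarith [pow_pos hpos 2]

end InnerProductSpace

/-- Distance Duality, part (ii): `p` does not lie in the convex hull of `S = {v 1, ..., v n}` iff
there exists a witness `p'` in the convex hull with `‖p' - v i‖ < ‖p - v i‖` for all `i`. -/
theorem distance_duality_not_mem (m n : ℕ) (hn : 1 ≤ n)
    (v : Fin n → EuclideanSpace ℝ (Fin m)) (p : EuclideanSpace ℝ (Fin m)) :
    p ∉ convexHull ℝ (Set.range v) ↔
      ∃ p' ∈ convexHull ℝ (Set.range v), ∀ i : Fin n, ‖p' - v i‖ < ‖p - v i‖ := by
  constructor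
  · intro hp
    have hne : (Set.range v).Nonempty := ⟨v ⟨0, hn⟩, Set.mem_range_self _⟩
    obtain ⟨q, hq, hlt⟩ := (convex_convexHull ℝ (Set.range v)).exists_forall_norm_sub_lt
      hne.convexHull ((Set.finite_range v).isCompact_convexHull ℝ).isComplete hp
    exact ⟨q, hq, fun i => hlt _ (subset_convexHull ℝ _ (Set.mem_range_self i))⟩
  · rintro ⟨q, -, hlt⟩ hp
    have hpq : ‖q - p‖ < ‖p - p‖ :=
      convexHull_min (Set.range_subset_iff.2 hlt) (convex_setOf_norm_sub_lt q p) hp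
    rw [sub_self, norm_zero] at hpq
    exact (norm_nonneg _).not_gt hpq
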